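/- Let m ≥ 1, let H be a finite Borel measure on the unit simplex S_m satisfying ∫_{S_m} w_i dH(w) = 1 for every i ∈ {1,…,m}, and let {V_B : B ∈ C_m} be the associated complete set of exponent measures. Then for every nonempty L ⊆ {1,…,m} and every y = (y_1,…,y_m) with y_i > 0 for all i, the alternating sum ∑_{B ∈ C_m, B ⊇ M_m∖L} (−1)^{|B ∩ L| + 1} V_B(y_B) is nonnegative. -/

import Mathlib

open MeasureTheory Finset

theorem aux_le {m : ℕ} (a : Fin m → ℝ) (B : Finset (Fin m)) (r : ℝ) (ha : ∀ i, 0 ≤ a i) :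
    (⨆ j ∈ B, a j) ≤ r ↔ 0 ≤ r ∧ ∀ j ∈ B, a j ≤ r := by
  constructor
  · intro h
    refine ⟨le_trans (Real.iSup_nonneg fun j => Real.iSup_nonneg fun _ => ha j) h, ?_⟩
    intro j hj
    refine le_trans ?_ h
    refine le_trans ?_ (le_ciSup (Set.finite_range _).bddAbove j)
    simp [hj]
  · rintro ⟨h0, h⟩
    exact Real.iSup_le (fun j => Real.iSup_le (fun hj => h j hj) h0) h0

theorem aux_insert {m : ℕ} (a : Fin m → ℝ) (ha : ∀ i, 0 ≤ a i) (x : Fin m)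
    (B : Finset (Fin m)) :
    (⨆ j ∈ insert x B, a j) = max (⨆ j ∈ B, a j) (a x) := by
  refine eq_of_forall_ge_iff fun r => ?_
  rw [aux_le a _ r ha, max_le_iff, aux_le a _ r ha]
  simp only [Finset.mem_insert, forall_eq_or_imp]
  tauto

theorem aux_sum {m : ℕ} (a : Fin m → ℝ) (f : Finset (Fin m) → ℝ)
    (hf : ∀ x B, f (insert x B) = max (f B) (a x)) (S : Finset (Fin m)) (hS : S.Nonempty) :
    ∃ b, ∀ K, ∑ T ∈ S.powerset, (-1 : ℝ) ^ (T.card + 1) * f (K ∪ T) = max (f K) b - f K := by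
  induction hS using Finset.Nonempty.cons_induction with
  | singleton x =>
    refine ⟨a x, fun K => ?_⟩
    have h : K ∪ {x} = insert x K := by ext; simp [or_comm]
    have hp : ({x} : Finset (Fin m)).powerset = {∅, {x}} := by
      ext T; simp [Finset.subset_singleton_iff]
    rw [hp, Finset.sum_pair (Finset.singleton_ne_empty x).symm, h, hf]
    simp
    ring
  | cons x S hx hS ih =>
    obtain ⟨b, hb⟩ := ih
    refine ⟨min b (a x), fun K => ?_⟩
    rw [Finset.cons_eq_insert, Finset.sum_powerset_insert hx, hb K]
    have h2 := hb (insert x K)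
    rw [hf] at h2
    have h3 : ∑ T ∈ S.powerset, (-1 : ℝ) ^ ((insert x T).card + 1) * f (K ∪ insert x T)
        = - ∑ T ∈ S.powerset, (-1 : ℝ) ^ (T.card + 1) * f (insert x K ∪ T) := by
      rw [← Finset.sum_neg_distrib]
      refine Finset.sum_congr rfl fun T hT => ?_
      have hxT : x ∉ T := fun h => hx (Finset.mem_powerset.1 hT h)
      rw [Finset.card_insert_of_notMem hxT, Finset.union_insert, Finset.insert_union]
      ring
    rw [h3, h2]
    grind

/-- For a finite Borel measure `H` on the unit simplex `S_m` with unit marginal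
means, the associated exponent measures `V_B` satisfy, for every nonempty `L ⊆ {1,…,m}` and
every `y` with positive coordinates,
`∑_{B ∈ C_m, B ⊇ M_m∖L} (−1)^{|B ∩ L| + 1} V_B(y_B) ≥ 0`. -/
theorem exponent_measures_alternating_sum_nonneg
    (m : ℕ) (hm : 1 ≤ m)
    (H : Measure (Fin m → ℝ)) [IsFiniteMeasure H]
    (hsupp : ∀ᵐ w ∂H, (∀ i, 0 ≤ w i) ∧ ∑ i, w i = 1)
    (hmarg : ∀ i : Fin m, ∫ w, w i ∂H = 1)
    (V : Finset (Fin m) → (Fin m → ℝ) → ℝ)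
    (hV : ∀ (B : Finset (Fin m)) (y : Fin m → ℝ),
        V B y = ∫ w, (⨆ j ∈ B, w j / y j) ∂H)
    (L : Finset (Fin m)) (hL : L.Nonempty)
    (y : Fin m → ℝ) (hy : ∀ i, 0 < y i) :
    0 ≤ ∑ B ∈ Finset.univ.filter
          (fun B : Finset (Fin m) => B.Nonempty ∧ Lᶜ ⊆ B),
        (-1 : ℝ) ^ ((B ∩ L).card + 1) * V B y := by
  classical
  have hae : ∀ᵐ w ∂H, ∀ i, 0 ≤ w i / y i := by
    filter_upwards [hsupp] with w hw i
    exact div_nonneg (hw.1 i) (hy i).le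
  have hint1 : ∀ i, Integrable (fun w : Fin m → ℝ => w i / y i) H := by
    intro i
    refine Integrable.div_const ?_ _
    by_contra h
    have := hmarg i
    rw [integral_undef h] at this
    exact zero_ne_one this
  have hint : ∀ B : Finset (Fin m),
      Integrable (fun w : Fin m → ℝ => ⨆ j ∈ B, w j / y j) H := by
    intro B
    induction B using Finset.induction_on with
    | empty => simp
    | insert x B hx ih =>
      refine (ih.sup (hint1 x)).congr ?_
      filter_upwards [hae] with w hw
      exact (aux_insert (fun j => w j / y j) hw x B).symm
  have hempty : V ∅ y = 0 := by
    rw [hV]; simp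
  have h1 : ∑ B ∈ Finset.univ.filter
          (fun B : Finset (Fin m) => B.Nonempty ∧ Lᶜ ⊆ B),
        (-1 : ℝ) ^ ((B ∩ L).card + 1) * V B y
      = ∑ B ∈ Finset.univ.filter (fun B : Finset (Fin m) => Lᶜ ⊆ B),
        (-1 : ℝ) ^ ((B ∩ L).card + 1) * V B y := by
    refine Finset.sum_subset (fun B hB => ?_) (fun B hB hB' => ?_)
    · simp only [Finset.mem_filter] at hB ⊢
      exact ⟨hB.1, hB.2.2⟩
    · have : B = ∅ := by
        by_contra hne
        apply hB'
        simp only [Finset.mem_filter] at hB ⊢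
        exact ⟨hB.1, Finset.nonempty_iff_ne_empty.2 hne, hB.2⟩
      rw [this, hempty, mul_zero]
  have h2 : ∑ B ∈ Finset.univ.filter (fun B : Finset (Fin m) => Lᶜ ⊆ B),
        (-1 : ℝ) ^ ((B ∩ L).card + 1) * V B y
      = ∑ T ∈ L.powerset, (-1 : ℝ) ^ (T.card + 1) * V (Lᶜ ∪ T) y := by
    refine Finset.sum_bij' (fun B _ => B ∩ L) (fun T _ => Lᶜ ∪ T) ?_ ?_ ?_ ?_ ?_
    · intro B _
      simp
    · intro T _
      simp
    · intro B hB
      simp only [Finset.mem_filter] at hB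
      ext j
      have := @hB.2 j
      simp only [Finset.mem_compl] at this
      simp only [Finset.mem_union, Finset.mem_compl, Finset.mem_inter]
      tauto
    · intro T hT
      ext j
      have : j ∈ T → j ∈ L := fun h => Finset.mem_powerset.1 hT h
      simp only [Finset.mem_union, Finset.mem_compl, Finset.mem_inter]
      tauto
    · intro B hB
      simp only [Finset.mem_filter] at hB
      have : Lᶜ ∪ B ∩ L = B := by
        ext j
        have := @hB.2 j
        simp only [Finset.mem_compl] at this
        simp only [Finset.mem_union, Finset.mem_compl, Finset.mem_inter]
        tauto
      simp only [this]
  rw [h1, h2]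
  simp only [hV, ← integral_const_mul]
  rw [← integral_finsetSum _ (fun T _ => (hint _).const_mul _)]
  refine integral_nonneg_of_ae ?_
  filter_upwards [hae] with w hw
  obtain ⟨b, hb⟩ := aux_sum (fun j => w j / y j) (fun B => ⨆ j ∈ B, w j / y j)
    (fun x B => aux_insert _ hw x B) L hL
  have := hb Lᶜ
  simp only [Pi.zero_apply]
  rw [this]
  exact sub_nonneg.2 (le_max_left _ _)
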